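/- arXiv:2410.16968 — 2 statements merged into one kernel-verified Lean document; each statement's English description precedes it below -/
import Mathlib

section
/- Let σ ≥ 2 and k ≥ 5, and write Δ_σ(w) = Dev_σ(k,w+1) − Dev_σ(k,w). Then Δ_σ(1) = σ/3, Δ_σ(2) = σ²/6, Δ_σ(3) = (2σ³ + 3σ² − 3σ)/20, and Δ_σ(4) = (2σ⁴ + 2σ³ − 6σ² + 4σ)/30. -/
open Finset

/-- The `i`-th length-`k` substring (`k`-mer) of a word of length `w + k`
over the alphabet `Fin σ`. -/
def kmerAt (σ k w : ℕ) (v : Fin (w + k) → Fin σ) (i : Fin (w + 1)) : Fin k → Fin σ :=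
  fun j => v ⟨i.1 + j.1, by have h1 := i.2; have h2 := j.2; omega⟩

/-- `v` is a gamechanger with respect to the linear order (ranking) `ρ` on `k`-mers:
either its `k`-prefix is a `ρ`-minimal `k`-mer of `v`, or its `k`-suffix is a
`ρ`-minimal `k`-mer of `v` occurring exactly once in `v`. -/
def IsGC (σ k w : ℕ) (ρ : (Fin k → Fin σ) ≃ Fin (σ ^ k)) (v : Fin (w + k) → Fin σ) : Prop :=
  (∀ i : Fin (w + 1), ρ (kmerAt σ k w v 0) ≤ ρ (kmerAt σ k w v i)) ∨
  ((∀ i : Fin (w + 1), ρ (kmerAt σ k w v (Fin.last w)) ≤ ρ (kmerAt σ k w v i)) ∧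
    (∀ i : Fin (w + 1), kmerAt σ k w v i = kmerAt σ k w v (Fin.last w) → i = Fin.last w))

/-- `P_{σ,k}(v)`: the fraction of linear orders `ρ` on `σ`-ary `k`-strings for which
`v` is a gamechanger. -/
noncomputable def Pgc (σ k w : ℕ) (v : Fin (w + k) → Fin σ) : ℝ :=
  (Nat.card {ρ : (Fin k → Fin σ) ≃ Fin (σ ^ k) // IsGC σ k w ρ v} : ℝ) /
    (Nat.card ((Fin k → Fin σ) ≃ Fin (σ ^ k)) : ℝ)

/-- `D_ρ`: the fraction of gamechangers among all `σ`-ary strings of length `w + k`. -/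
noncomputable def Dens (σ k w : ℕ) (ρ : (Fin k → Fin σ) ≃ Fin (σ ^ k)) : ℝ :=
  (Nat.card {v : Fin (w + k) → Fin σ // IsGC σ k w ρ v} : ℝ) / ((σ : ℝ) ^ (w + k))

/-- `DR_σ(k,w)`: the expected density, i.e. the average of `D_ρ` over all orders `ρ`. -/
noncomputable def DR (σ k w : ℕ) : ℝ :=
  (∑ ρ : (Fin k → Fin σ) ≃ Fin (σ ^ k), Dens σ k w ρ) /
    (Nat.card ((Fin k → Fin σ) ≃ Fin (σ ^ k)) : ℝ)

/-- `DFR_σ(k,w) = (w+1) · DR_σ(k,w)`, the expected density factor. -/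
noncomputable def DFR (σ k w : ℕ) : ℝ := ((w : ℝ) + 1) * DR σ k w

/-- The number of distinct `k`-mers of `v`. -/
def numKmers (σ k w : ℕ) (v : Fin (w + k) → Fin σ) : ℕ :=
  (Finset.univ.image (kmerAt σ k w v)).card

/-- `Rep_{σ,k,w}`: the set of `σ`-ary strings of length `w + k` that contain two equal
`k`-substrings at distinct positions. -/
def RepSet (σ k w : ℕ) : Finset (Fin (w + k) → Fin σ) :=
  Finset.univ.filter fun v =>
    ∃ i j : Fin (w + 1), i ≠ j ∧ kmerAt σ k w v i = kmerAt σ k w v j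

/-- `Dev_σ(k,w)`, the deviation of the random order. -/
noncomputable def Dev (σ k w : ℕ) : ℝ :=
  (∑ v ∈ RepSet σ k w, Pgc σ k w v) - (2 / ((w : ℝ) + 1)) * ((RepSet σ k w).card : ℝ)

/-- `p` is a period of the string `s` (of length `n`): `s[i] = s[i+p]` whenever both
positions are inside `s`. -/
def HasPeriod (σ n : ℕ) (s : Fin n → Fin σ) (p : ℕ) : Prop :=
  ∀ (i : ℕ) (h : i + p < n), s ⟨i, by omega⟩ = s ⟨i + p, h⟩

/-- A string is primitive if it is not of the form `u^m` with `m ≥ 2`, equivalently it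
has no period that is a proper divisor of its length. -/
def IsPrimitive (σ n : ℕ) (s : Fin n → Fin σ) : Prop :=
  ¬ ∃ d, d ∣ n ∧ d < n ∧ HasPeriod σ n s d

/-- `Prim_σ(n)`: the number of primitive `σ`-ary strings of length `n`. -/
noncomputable def Prim (σ n : ℕ) : ℕ :=
  Nat.card {s : Fin n → Fin σ // IsPrimitive σ n s}

/-- The substring of `v` of length `ℓ` starting at (0-indexed) position `i`. -/
def subAt (σ n : ℕ) (v : Fin n → Fin σ) (i ℓ : ℕ) (h : i + ℓ ≤ n) : Fin ℓ → Fin σ :=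
  fun j => v ⟨i + j.1, by have := j.2; omega⟩

/-- A string is `p`-periodic if `p` is its minimal period and `p ≤ |s|/2`. -/
def IsPPeriodic (σ n : ℕ) (s : Fin n → Fin σ) (p : ℕ) : Prop :=
  1 ≤ p ∧ 2 * p ≤ n ∧ HasPeriod σ n s p ∧ ∀ q, 1 ≤ q → q < p → ¬ HasPeriod σ n s q

/-- The occurrence `v[i..i+ℓ)` is a run of period `p`: it is `p`-periodic and is not
contained in a longer `p`-periodic substring of `v`. -/
def IsRun (σ n : ℕ) (v : Fin n → Fin σ) (i ℓ p : ℕ) (h : i + ℓ ≤ n) : Prop :=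
  IsPPeriodic σ ℓ (subAt σ n v i ℓ h) p ∧
    ∀ (i' ℓ' : ℕ) (h' : i' + ℓ' ≤ n), i' ≤ i → i + ℓ ≤ i' + ℓ' → ℓ < ℓ' →
      ¬ IsPPeriodic σ ℓ' (subAt σ n v i' ℓ' h') p

/-- A major run: a run `x` of period `p` with `|x| ≥ |v|/2 + p`. -/
def IsMajorRun (σ n : ℕ) (v : Fin n → Fin σ) (i ℓ p : ℕ) (h : i + ℓ ≤ n) : Prop :=
  IsRun σ n v i ℓ p h ∧ n + 2 * p ≤ 2 * ℓ

open Classical in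
theorem perm_min_card {α : Type*} [Fintype α] {n : ℕ} (S : Finset α) (x : α) (hx : x ∈ S) :
    (Finset.univ.filter fun ρ : α ≃ Fin n => ∀ y ∈ S, ρ x ≤ ρ y).card * S.card
      = Fintype.card (α ≃ Fin n) := by
  have hall : (Finset.univ : Finset (α ≃ Fin n)) =
      S.biUnion fun z => Finset.univ.filter fun ρ : α ≃ Fin n => ∀ y ∈ S, ρ z ≤ ρ y := by
    ext ρ
    simp only [Finset.mem_univ, Finset.mem_biUnion, Finset.mem_filter, true_and, true_iff]
    exact Finset.exists_min_image S ρ ⟨x, hx⟩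
  have hc := congrArg Finset.card hall
  rw [← Finset.card_univ, hc, Finset.card_biUnion]
  · rw [Finset.sum_const_nat (m := (Finset.univ.filter
      fun ρ : α ≃ Fin n => ∀ y ∈ S, ρ x ≤ ρ y).card), mul_comm]
    intro z hz
    have key : ∀ (x z : α), x ∈ S → z ∈ S → ∀ ρ : α ≃ Fin n, (∀ y ∈ S, ρ x ≤ ρ y) →
        ∀ y ∈ S, ((Equiv.swap x z).trans ρ) z ≤ ((Equiv.swap x z).trans ρ) y := by
      intro x z hx hz ρ h y hy
      simp only [Equiv.trans_apply, Equiv.swap_apply_right]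
      apply h
      rcases Equiv.swap_apply_def x z y with h
      rw [h]
      split_ifs <;> assumption
    apply Finset.card_bij' (fun ρ _ => (Equiv.swap z x).trans ρ)
      (fun ρ _ => (Equiv.swap z x).trans ρ)
    · intro ρ h
      simp only [Finset.mem_filter, Finset.mem_univ, true_and] at h ⊢
      exact key z x hz hx ρ h
    · intro ρ h
      simp only [Finset.mem_filter, Finset.mem_univ, true_and] at h ⊢
      rw [Equiv.swap_comm]
      exact key x z hx hz ρ h
    · intro ρ _
      ext y
      simp
    · intro ρ _
      ext y
      simp
  · intro z hz z' hz' hne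
    rw [Function.onFun, Finset.disjoint_left]
    intro ρ h h'
    simp only [Finset.mem_filter, Finset.mem_univ, true_and] at h h'
    exact hne (ρ.injective (le_antisymm (h z' hz') (h' z hz)))

theorem perm_min_card' {α : Type*} [Fintype α] {n : ℕ} (S : Finset α) (x : α) (hx : x ∈ S) :
    ∃ A : Finset (α ≃ Fin n), (∀ ρ, ρ ∈ A ↔ ∀ y ∈ S, ρ x ≤ ρ y) ∧
      A.card * S.card = Nat.card (α ≃ Fin n) := by
  classical
  refine ⟨_, ?_, (perm_min_card S x hx).trans Nat.card_eq_fintype_card.symm⟩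
  intro ρ
  simp

open Classical in
theorem Pgc_formula (σ k w : ℕ) (hw : 1 ≤ w) (v : Fin (w + k) → Fin σ) :
    Pgc σ k w v = (1 + if (∀ i : Fin (w + 1), kmerAt σ k w v i = kmerAt σ k w v (Fin.last w) →
      i = Fin.last w) then (1:ℝ) else 0) / (numKmers σ k w v : ℝ) := by
  unfold Pgc
  set S := Finset.univ.image (kmerAt σ k w v) with hS
  have hmem : ∀ i, kmerAt σ k w v i ∈ S := fun i => by simp [hS]
  have hSn : (numKmers σ k w v : ℝ) = S.card := rfl
  have hSpos : 0 < S.card := Finset.card_pos.2 ⟨_, hmem 0⟩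
  have hNpos : 0 < Fintype.card ((Fin k → Fin σ) ≃ Fin (σ ^ k)) := by
    rw [Fintype.card_pos_iff]
    exact ⟨Fintype.equivFinOfCardEq (by simp)⟩
  obtain ⟨A, hA1, h1⟩ := perm_min_card' (n := σ ^ k) S _ (hmem 0)
  obtain ⟨B, hA2, h2⟩ := perm_min_card' (n := σ ^ k) S _ (hmem (Fin.last w))
  have hconv : ∀ (x : Fin k → Fin σ) (ρ : (Fin k → Fin σ) ≃ Fin (σ ^ k)),
      (∀ y ∈ S, ρ x ≤ ρ y) ↔ ∀ i, ρ x ≤ ρ (kmerAt σ k w v i) := by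
    intro x ρ
    simp [hS]
  simp only [hconv] at hA1 hA2
  rw [Nat.card_eq_fintype_card] at h1 h2
  have h1' := congrArg (Nat.cast : ℕ → ℝ) h1
  have h2' := congrArg (Nat.cast : ℕ → ℝ) h2
  push_cast at h1' h2'
  have hS0 : (0:ℝ) < S.card := by exact_mod_cast hSpos
  have hN0 : (0:ℝ) < Fintype.card ((Fin k → Fin σ) ≃ Fin (σ ^ k)) := by exact_mod_cast hNpos
  rw [Nat.card_eq_fintype_card, Nat.card_eq_fintype_card, Fintype.card_subtype, hSn]
  split_ifs with hu
  · have hU : (Finset.univ.filter fun ρ => IsGC σ k w ρ v) = A ∪ B := by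
      ext ρ
      rw [Finset.mem_filter, Finset.mem_union, hA1, hA2, IsGC, and_iff_left hu]
      simp
    rw [hU, Finset.card_union_of_disjoint]
    · push_cast
      rw [div_eq_div_iff (by positivity) (by positivity)]
      linarith
    · rw [Finset.disjoint_left]
      intro ρ h h'
      rw [hA1] at h
      rw [hA2] at h'
      have := ρ.injective (le_antisymm (h (Fin.last w)) (h' 0))
      have := hu _ this
      have := congrArg Fin.val this
      simp at this
      omega
  · have hU : (Finset.univ.filter fun ρ => IsGC σ k w ρ v) = A := by
      ext ρ
      rw [Finset.mem_filter, hA1, IsGC, eq_false hu, and_false, or_false]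
      simp
    rw [hU, div_eq_div_iff (by positivity) (by positivity)]
    linarith

def Per (f : ℕ → ℕ) (s e p : ℕ) : Prop := ∀ i, s ≤ i → i + p < e → f i = f (i + p)

theorem Per.mono {f : ℕ → ℕ} {s e p s' e' : ℕ} (h : Per f s e p) (hs : s ≤ s') (he : e' ≤ e) :
    Per f s' e' p := fun i h1 h2 => h i (by omega) (by omega)

theorem Per.mul {f : ℕ → ℕ} {s e p : ℕ} (h : Per f s e p) (m : ℕ) : Per f s e (p * m) := by
  induction m with
  | zero => intro i _ _; simp
  | succ m ih =>
    intro i h1 h2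
    rw [Nat.mul_succ] at h2 ⊢
    rw [ih i h1 (by omega), h (i + p * m) (by omega) (by omega), add_assoc]

theorem Per.dvd {f : ℕ → ℕ} {s e p q : ℕ} (h : Per f s e p) (hd : p ∣ q) : Per f s e q := by
  obtain ⟨m, rfl⟩ := hd
  exact h.mul m

theorem fine_wilf (f : ℕ → ℕ) (s e : ℕ) : ∀ (N p q : ℕ), p + q ≤ N → 0 < p → 0 < q →
    s + p + q ≤ e → Per f s e p → Per f s e q → Per f s e (Nat.gcd p q) := by
  have step : ∀ p q, p < q → s + p + q ≤ e → Per f s e p → Per f s e q → Per f s e (q - p) := by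
    intro p q hpq hl hp hq i h1 h2
    by_cases h : i + q < e
    · rw [hq i h1 h, hp (i + (q - p)) (by omega) (by omega)]
      congr 1; omega
    · have a1 := hp (i - p) (by omega) (by omega)
      have a2 := hq (i - p) (by omega) (by omega)
      rw [show i - p + p = i by omega] at a1
      rw [← a1, a2]
      congr 1; omega
  intro N
  induction N with
  | zero => intros; omega
  | succ N ih =>
    intro p q hN hp0 hq0 hl hp hq
    rcases lt_trichotomy p q with h | h | h
    · have := ih p (q - p) (by omega) hp0 (by omega) (by omega) hp (step p q h hl hp hq)
      rwa [Nat.gcd_sub_self_right h.le] at this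
    · subst h; simpa using hp
    · have := ih (p - q) q (by omega) (by omega) hq0 (by omega)
        (step q p h (by omega) hq hp) hq
      rwa [Nat.gcd_sub_self_left h.le] at this

/-- Extend a period `g ∣ q` from a subwindow of length at least `q` to a `q`-periodic window. -/
theorem Per.extend {f : ℕ → ℕ} {s e s' e' q g : ℕ} (hq0 : 0 < q) (hq : Per f s e q)
    (hg : Per f s' e' g) (hd : g ∣ q) (hs : s ≤ s') (he : e' ≤ e) (hl : s' + q ≤ e') :
    Per f s e g := by
  have hgq : g ≤ q := Nat.le_of_dvd hq0 hd
  have hgq' : Per f s' e' q := hg.dvd hd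
  -- extend to the right
  have R : ∀ i, s' ≤ i → i + g < e → f i = f (i + g) := by
    intro i
    induction i using Nat.strong_induction_on with
    | _ i ih =>
      intro h1 h2
      by_cases h : i + g < e'
      · exact hg i h1 h
      · by_cases h3 : s' + q ≤ i
        · have a := ih (i - q) (by omega) (by omega) (by omega)
          have b := hq (i - q) (by omega) (by omega)
          have c := hq (i - q + g) (by omega) (by omega)
          rw [show i - q + q = i by omega] at b
          rw [show i - q + g + q = i + g by omega] at c
          rw [← b, ← c, a]
        · -- i < s' + q, i + g ≥ e' ≥ s' + q
          have c := hq (i + g - q) (by omega) (by omega)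
          rw [show i + g - q + q = i + g by omega] at c
          rw [← c]
          have := hg.dvd (Nat.dvd_sub hd (dvd_refl g)) (i + g - q) (by omega) (by omega)
          rw [this]; congr 1; omega
  have L : ∀ t i, i + t = s' → s ≤ i → i + g < e → f i = f (i + g) := by
    intro t
    induction t using Nat.strong_induction_on with
    | _ t ih =>
      intro i h1 h2 h3
      have R' : ∀ j, i < j → j + g < e → f j = f (j + g) := by
        intro j hj hj2
        by_cases h : s' ≤ j
        · exact R j h hj2
        · exact ih (s' - j) (by omega) j (by omega) (by omega) hj2
      by_cases h0 : t = 0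
      · exact R i (by omega) h3
      rw [hq i h2 (by omega)]
      have hP : Per f (i + 1) e g := fun j a b => R' j (by omega) b
      have := hP.dvd (Nat.dvd_sub hd (dvd_refl g)) 
      by_cases hg0 : g = 0
      · subst hg0; rw [Nat.eq_zero_of_zero_dvd hd]
      rw [this (i + g) (by omega) (by omega)]
      congr 1; omega
  intro i h1 h2
  by_cases h : s' ≤ i
  · exact R i h h2
  · exact L (s' - i) i (by omega) h1 h2

def XX (f : ℕ → ℕ) (n p a b : ℕ) : Prop :=
  Per f a (n - b) p ∧ (0 < a → ¬ Per f (a - 1) (n - b) p) ∧ (0 < b → ¬ Per f a (n - b + 1) p)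

def EE (f : ℕ → ℕ) (n p a b : ℕ) : Prop :=
  XX f n p a b ∧ ∀ q, 0 < q → q < p → q ∣ p → ¬ Per f a (n - b) q

theorem EE_key {f : ℕ → ℕ} {w k p a b i j : ℕ} (hwk : w ≤ k) (hp : 0 < p) (hab : a + b + p ≤ w)
    (hE : EE f (w + k) p a b) (hij : i < j) (hj : j ≤ w) (h : Per f i (j + k) (j - i)) :
    a ≤ i ∧ j + b ≤ w ∧ p ∣ j - i := by
  obtain ⟨⟨h1, h2, h3⟩, h4⟩ := hE
  set q := j - i with hq
  set s := max a i with hs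
  set e := min (w + k - b) (j + k) with he
  have hl : s + p + q ≤ e := by omega
  have hg : Per f s e (Nat.gcd p q) := fine_wilf f s e _ p q le_rfl hp (by omega) hl
    (h1.mono (by omega) (by omega)) (h.mono (by omega) (by omega))
  have hgp : Nat.gcd p q = p := by
    by_contra hne
    have hle := Nat.gcd_le_left q hp
    refine h4 (Nat.gcd p q) (Nat.gcd_pos_of_pos_left _ hp) (by omega) (Nat.gcd_dvd_left _ _) ?_
    exact h1.extend hp hg (Nat.gcd_dvd_left _ _) (by omega) (by omega) (by omega)
  rw [hgp] at hg
  have hpq : p ∣ q := by rw [← hgp]; exact Nat.gcd_dvd_right _ _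
  have hP : Per f i (j + k) p := h.extend (by omega) hg hpq (by omega) (by omega) (by omega)
  refine ⟨?_, ?_, hpq⟩
  · by_contra hlt
    apply h2 (by omega)
    intro t ht1 ht2
    by_cases ht : a ≤ t
    · exact h1 t ht ht2
    · exact hP t (by omega) (by omega)
  · by_contra hlt
    apply h3 (by omega)
    intro t ht1 ht2
    by_cases ht : t + p < w + k - b
    · exact h1 t ht1 ht
    · exact hP t (by omega) (by omega)

theorem EE_conv {f : ℕ → ℕ} {w k p a b i j : ℕ} 
    (hE : EE f (w + k) p a b) (hij : i < j) (hai : a ≤ i) (hj : j + b ≤ w) (hd : p ∣ j - i) :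
    Per f i (j + k) (j - i) :=
  (hE.1.1.dvd hd).mono hai (by omega)

theorem EE_exists {f : ℕ → ℕ} {w k i j : ℕ} 
    (hij : i < j) (hj : j ≤ w) (h : Per f i (j + k) (j - i)) :
    ∃ p a b, 0 < p ∧ a + b + p ≤ w ∧ EE f (w + k) p a b := by
  classical
  have hex : ∃ p, 0 < p ∧ ∃ i, i + p ≤ w ∧ Per f i (i + p + k) p :=
    ⟨j - i, by omega, i, by omega, by rwa [show i + (j - i) = j by omega]⟩
  let p := Nat.find hex
  obtain ⟨hp, i, hi, hP⟩ : 0 < p ∧ ∃ i, i + p ≤ w ∧ Per f i (i + p + k) p := Nat.find_spec hex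
  have hmin : ∀ q, q < p → ¬ (0 < q ∧ ∃ i, i + q ≤ w ∧ Per f i (i + q + k) q) :=
    fun q hq => Nat.find_min hex hq
  clear_value p
  have hexb : ∃ b, b + i + p ≤ w ∧ Per f i (w + k - b) p :=
    ⟨w - (i + p), by omega, hP.mono le_rfl (by omega)⟩
  let b := Nat.find hexb
  obtain ⟨hb, hPb⟩ : b + i + p ≤ w ∧ Per f i (w + k - b) p := Nat.find_spec hexb
  have hbmin : ∀ c, c < b → ¬ (c + i + p ≤ w ∧ Per f i (w + k - c) p) :=
    fun q hq => Nat.find_min hexb hq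
  clear_value b
  have hexa : ∃ a, a ≤ i ∧ Per f a (w + k - b) p := ⟨i, le_rfl, hPb⟩
  let a := Nat.find hexa
  obtain ⟨ha, hPa⟩ : a ≤ i ∧ Per f a (w + k - b) p := Nat.find_spec hexa
  have hamin : ∀ c, c < a → ¬ (c ≤ i ∧ Per f c (w + k - b) p) :=
    fun q hq => Nat.find_min hexa hq
  clear_value a
  refine ⟨p, a, b, hp, by omega, ⟨hPa, ?_, ?_⟩, ?_⟩
  · intro h0 hc
    exact hamin (a - 1) (by omega) ⟨by omega, hc⟩
  · intro h0 hc
    exact hbmin (b - 1) (by omega) ⟨by omega, hc.mono ha (by omega)⟩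
  · intro q hq hqp _ hc
    exact hmin q hqp ⟨hq, a, by omega, hc.mono le_rfl (by omega)⟩

theorem EE_unique {f : ℕ → ℕ} {w k p a b p' a' b' : ℕ} (hwk : w ≤ k) (hp : 0 < p)
    (hab : a + b + p ≤ w) (hE : EE f (w + k) p a b) (hp' : 0 < p')
    (hab' : a' + b' + p' ≤ w) (hE' : EE f (w + k) p' a' b') : p = p' ∧ a = a' ∧ b = b' := by
  have A : ∀ {p a b p' a' b' : ℕ}, 0 < p → a + b + p ≤ w → EE f (w + k) p a b → 0 < p' →
      a' + b' + p' ≤ w → EE f (w + k) p' a' b' → p' ∣ p ∧ a' ≤ a ∧ b' ≤ b := by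
    intro p a b p' a' b' hp hab hE hp' hab' hE'
    have h1 := EE_conv (i := a) (j := a + p) hE (by omega) le_rfl (by omega) (by simp)
    have h2 := EE_conv (i := w - b - p) (j := w - b) hE (by omega) (by omega) (by omega)
      (by rw [show w - b - (w - b - p) = p by omega])
    have k1 := EE_key hwk hp' hab' hE' (by omega) (by omega) h1
    have k2 := EE_key hwk hp' hab' hE' (by omega) (by omega) h2
    refine ⟨by simpa using k1.2.2, k1.1, by omega⟩
  have h1 := A hp hab hE hp' hab' hE'
  have h2 := A hp' hab' hE' hp hab hE
  exact ⟨Nat.dvd_antisymm h2.1 h1.1, by omega, by omega⟩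

def extF {σ n : ℕ} (v : Fin n → Fin σ) (i : ℕ) : ℕ := if h : i < n then (v ⟨i, h⟩ : ℕ) else 0

theorem kmer_eq_iff {σ k w : ℕ} (v : Fin (w + k) → Fin σ) (i j : Fin (w + 1)) (hij : i < j) :
    kmerAt σ k w v i = kmerAt σ k w v j ↔ Per (extF v) i (j + k) (j - i) := by
  have hij' : i.1 < j.1 := hij
  have hj := j.2
  constructor
  · intro h t h1 h2
    have := congrArg Fin.val (congrFun h ⟨t - i, by omega⟩)
    simp only [kmerAt] at this
    unfold extF
    rw [dif_pos (by omega), dif_pos (by omega)]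
    convert this using 4 <;> omega
  · intro h
    funext t
    have ht := t.2
    have := h (i + t) (by omega) (by omega)
    unfold extF at this
    rw [dif_pos (by omega), dif_pos (by omega)] at this
    apply Fin.ext
    simp only [kmerAt]
    convert this using 4
    omega

theorem kmer_EE {σ k w p a b : ℕ} (hwk : w ≤ k) (hp : 0 < p) (hab : a + b + p ≤ w)
    (v : Fin (w + k) → Fin σ) (hE : EE (extF v) (w + k) p a b) (i j : Fin (w + 1)) (hij : i < j) :
    kmerAt σ k w v i = kmerAt σ k w v j ↔ a ≤ i.1 ∧ j.1 + b ≤ w ∧ p ∣ j.1 - i.1 := by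
  rw [kmer_eq_iff v i j hij]
  have hj := j.2
  exact ⟨fun h => EE_key hwk hp hab hE hij (by omega) h, fun h => EE_conv hE hij h.1 h.2.1 h.2.2⟩

theorem numKmers_EE {σ k w p a b : ℕ} (hwk : w ≤ k) (hp : 0 < p) (hab : a + b + p ≤ w)
    (v : Fin (w + k) → Fin σ) (hE : EE (extF v) (w + k) p a b) :
    numKmers σ k w v = a + b + p := by
  unfold numKmers
  let g : Fin (a + b + p) → Fin (w + 1) := fun t =>
    ⟨if t.1 < a + p then t.1 else w + 1 - (a + b + p) + t.1, by
      have := t.2; split_ifs <;> omega⟩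
  have : Finset.univ.image (kmerAt σ k w v) =
      Finset.univ.image (fun t => kmerAt σ k w v (g t)) := by
    apply Finset.Subset.antisymm
    · intro x hx
      simp only [Finset.mem_image, Finset.mem_univ, true_and] at hx ⊢
      obtain ⟨i, rfl⟩ := hx
      have hi := i.2
      by_cases h1 : i.1 < a + p
      · refine ⟨⟨i.1, by omega⟩, ?_⟩
        congr 1
        simp [g, h1]
      · by_cases h2 : w < i.1 + b
        · refine ⟨⟨i.1 - (w + 1 - (a + b + p)), by omega⟩, ?_⟩
          congr 1
          apply Fin.ext
          simp only [g]
          rw [if_neg (by omega)]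
          omega
        · have hm := Nat.mod_lt (i.1 - a) hp
          have hdm := Nat.mod_add_div (i.1 - a) p
          have hle := Nat.mod_le (i.1 - a) p
          have hgv : (g ⟨a + (i.1 - a) % p, by omega⟩).1 = a + (i.1 - a) % p := by
            simp only [g]; rw [if_pos (by omega)]
          refine ⟨⟨a + (i.1 - a) % p, by omega⟩, ?_⟩
          rw [kmer_EE hwk hp hab v hE _ _ (by rw [Fin.lt_def, hgv]; omega), hgv]
          refine ⟨by omega, by omega, ⟨(i.1 - a) / p, by omega⟩⟩
    · intro x hx
      simp only [Finset.mem_image, Finset.mem_univ, true_and] at hx ⊢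
      obtain ⟨i, rfl⟩ := hx
      exact ⟨_, rfl⟩
  rw [this, Finset.card_image_of_injective]
  · simp
  · have key : ∀ s t : Fin (a + b + p), s < t →
        kmerAt σ k w v (g s) ≠ kmerAt σ k w v (g t) := by
      intro s t hst heq
      have hst' : s.1 < t.1 := hst
      have hs := s.2
      have ht := t.2
      have hlt : g s < g t := by
        rw [Fin.lt_def]; simp only [g]; split_ifs <;> omega
      rw [kmer_EE hwk hp hab v hE _ _ hlt] at heq
      rw [Fin.lt_def] at hlt
      have hle := Nat.le_of_dvd (by omega) heq.2.2
      simp only [g] at heq hle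
      split_ifs at heq hle <;> omega
    intro s t hst
    rcases lt_trichotomy s t with h | h | h
    · exact absurd hst (key s t h)
    · exact h
    · exact absurd hst.symm (key t s h)

theorem Pgc_EE {σ k w p a b : ℕ} (hwk : w ≤ k) (hp : 0 < p) (hab : a + b + p ≤ w)
    (v : Fin (w + k) → Fin σ) (hE : EE (extF v) (w + k) p a b) :
    Pgc σ k w v = (1 + if 0 < b then (1:ℝ) else 0) / ((a + b + p : ℕ) : ℝ) := by
  rw [Pgc_formula σ k w (by omega), numKmers_EE hwk hp hab v hE]
  congr 3
  apply propext
  constructor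
  · intro h
    by_contra hb
    have hlt : (⟨w - p, by omega⟩ : Fin (w + 1)) < Fin.last w := by
      rw [Fin.lt_def]; simp only [Fin.val_last]; omega
    have := h ⟨w - p, by omega⟩ ((kmer_EE hwk hp hab v hE _ _ hlt).2 ⟨by simp; omega, by simp; omega,
      by simp only [Fin.val_last]; rw [show w - (w - p) = p by omega]⟩)
    exact absurd this hlt.ne
  · intro hb i hi
    by_contra hne
    have hlt : i < Fin.last w := lt_of_le_of_ne (Fin.le_last i) hne
    have := (kmer_EE hwk hp hab v hE _ _ hlt).1 hi
    simp at this
    omega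

open Classical in
theorem card_Per (σ n p a b : ℕ) (hp : 0 < p) (hn : a + b + p ≤ n) :
    (Finset.univ.filter fun v : Fin n → Fin σ => Per (extF v) a (n - b) p).card
      = σ ^ (a + b + p) := by
  have : σ ^ (a + b + p) = (Finset.univ : Finset (Fin (a + b + p) → Fin σ)).card := by simp
  rw [this]
  let g : Fin (a + b + p) → Fin n := fun t =>
    ⟨if t.1 < a + p then t.1 else n - (a + b + p) + t.1, by
      have := t.2; split_ifs <;> omega⟩
  let h : Fin n → Fin (a + b + p) := fun i =>
    ⟨if i.1 < a then i.1 else if i.1 < n - b then a + (i.1 - a) % p else i.1 - (n - (a + b + p)), by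
      have := i.2; have := Nat.mod_lt (i.1 - a) hp; split_ifs <;> omega⟩
  have hgh : ∀ t, h (g t) = t := by
    intro t
    have ht := t.2
    apply Fin.ext
    simp only [g, h]
    by_cases h1 : t.1 < a
    · simp only [if_pos (show t.1 < a + p by omega), if_pos h1]
    · by_cases h2 : t.1 < a + p
      · simp only [if_pos h2, if_neg h1, if_pos (show t.1 < n - b by omega)]
        rw [Nat.mod_eq_of_lt (by omega)]; omega
      · simp only [if_neg h2]
        rw [if_neg (by omega), if_neg (by omega)]; omega
  apply Finset.card_bij' (fun v _ => v ∘ g) (fun u _ => u ∘ h)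
  · intros; simp
  · intro u _
    simp only [Finset.mem_filter, Finset.mem_univ, true_and]
    intro i h1 h2
    unfold extF
    rw [dif_pos (by omega), dif_pos (by omega)]
    simp only [Function.comp]
    congr 2
    apply Fin.ext
    simp only [h]
    rw [if_neg (by omega), if_pos (by omega), if_neg (by omega), if_pos (by omega),
      show i + p - a = i - a + p by omega, Nat.add_mod_right]
  · intro v hv
    simp only [Finset.mem_filter, Finset.mem_univ, true_and] at hv
    funext i
    have hi := i.2
    simp only [Function.comp]
    by_cases h1 : i.1 < a
    · congr 1
      apply Fin.ext
      simp only [g, h, if_pos h1, if_pos (show i.1 < a + p by omega)]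
    · by_cases h2 : i.1 < n - b
      · have hm := Nat.mod_lt (i.1 - a) hp
        have hdm := Nat.mod_add_div (i.1 - a) p
        have hle := Nat.mod_le (i.1 - a) p
        have := hv.mul ((i.1 - a) / p) (a + (i.1 - a) % p) (by omega) (by omega)
        unfold extF at this
        rw [dif_pos (by omega), dif_pos (by omega)] at this
        apply Fin.ext
        convert this using 3
        · apply Fin.ext
          simp only [g, h, if_neg h1, if_pos h2]
          rw [if_pos (by omega)]
        · apply Fin.ext
          simp only
          omega
      · congr 1
        apply Fin.ext
        simp only [g, h, if_neg h1, if_neg h2]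
        rw [if_neg (by omega)]
        omega
  · intro u _
    funext t
    simp only [Function.comp, hgh]

/-- weight of an extension -/
def cc (σ : ℕ) : ℕ → ℤ
  | 0 => 1
  | (j + 1) => ((σ : ℤ) - 1) * (σ : ℤ) ^ j

open Classical in
theorem card_XX (σ n p a b : ℕ) (hp : 0 < p) (hn : a + b + p + 1 ≤ n) :
    ((Finset.univ.filter fun v : Fin n → Fin σ => XX (extF v) n p a b).card : ℤ)
      = (σ : ℤ) ^ p * cc σ a * cc σ b := by
  -- one sided count
  have one : ∀ a b, a + b + p ≤ n →
      ((Finset.univ.filter fun v : Fin n → Fin σ => Per (extF v) a (n - b) p ∧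
        (0 < a → ¬ Per (extF v) (a - 1) (n - b) p)).card : ℤ) = σ ^ (p + b) * cc σ a := by
    intro a b h
    rcases a with _ | a
    · simp only [lt_irrefl, false_imp_iff, and_true]
      rw [card_Per σ n p 0 b hp h]
      simp [cc]
      ring
    · simp only [Nat.succ_pos, true_imp_iff, Nat.add_sub_cancel]
      rw [Finset.filter_and_not, Finset.card_sdiff_of_subset, Nat.cast_sub,
        card_Per σ n p (a + 1) b hp h, card_Per σ n p a b hp (by omega)]
      · push_cast; simp only [cc]; ring
      · apply Finset.card_le_card
        intro v
        simp only [Finset.mem_filter, Finset.mem_univ, true_and]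
        exact fun h => h.mono (by omega) le_rfl
      · intro v
        simp only [Finset.mem_filter, Finset.mem_univ, true_and]
        exact fun h => h.mono (by omega) le_rfl
  rcases b with _ | b
  · have := one a 0 (by omega)
    simp only [XX, lt_irrefl, false_imp_iff, and_true]
    rw [this]; simp [cc]
  · have e1 : (Finset.univ.filter fun v : Fin n → Fin σ => XX (extF v) n p a (b + 1)) =
        (Finset.univ.filter fun v : Fin n → Fin σ => Per (extF v) a (n - (b + 1)) p ∧
        (0 < a → ¬ Per (extF v) (a - 1) (n - (b + 1)) p)) \
        (Finset.univ.filter fun v : Fin n → Fin σ => Per (extF v) a (n - b) p ∧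
        (0 < a → ¬ Per (extF v) (a - 1) (n - b) p)) := by
      ext v
      simp only [XX, Finset.mem_filter, Finset.mem_univ, true_and, Finset.mem_sdiff,
        Nat.succ_pos, true_imp_iff, show n - (b + 1) + 1 = n - b by omega]
      constructor
      · rintro ⟨h1, h2, h3⟩
        exact ⟨⟨h1, h2⟩, fun h => h3 h.1⟩
      · rintro ⟨⟨h1, h2⟩, h3⟩
        refine ⟨h1, h2, fun h => h3 ⟨h, fun ha hc => h2 ha (hc.mono le_rfl (by omega))⟩⟩
    have sub : (Finset.univ.filter fun v : Fin n → Fin σ => Per (extF v) a (n - b) p ∧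
        (0 < a → ¬ Per (extF v) (a - 1) (n - b) p)) ⊆
        (Finset.univ.filter fun v : Fin n → Fin σ => Per (extF v) a (n - (b + 1)) p ∧
        (0 < a → ¬ Per (extF v) (a - 1) (n - (b + 1)) p)) := by
      intro v
      simp only [Finset.mem_filter, Finset.mem_univ, true_and]
      rintro ⟨h1, h2⟩
      refine ⟨h1.mono le_rfl (by omega), fun ha hc => h2 ha ?_⟩
      intro t ht1 ht2
      by_cases ht : a ≤ t
      · exact h1 t ht ht2
      · exact hc t ht1 (by omega)
    rw [e1, Finset.card_sdiff_of_subset sub, Nat.cast_sub (Finset.card_le_card sub),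
      one a (b + 1) (by omega), one a b (by omega)]
    simp only [cc]; ring

/-- number of primitive words of length p ≤ 5 -/
def pr (σ : ℕ) : ℕ → ℤ
  | 1 => σ
  | 2 => (σ : ℤ) ^ 2 - σ
  | 3 => (σ : ℤ) ^ 3 - σ
  | 4 => (σ : ℤ) ^ 4 - (σ : ℤ) ^ 2
  | 5 => (σ : ℤ) ^ 5 - σ
  | _ => 0

open Classical in
theorem card_EE_step (σ n p a b d : ℕ) (hd0 : 0 < d) (hd : d ∣ p) (hdp : d < p)
    (hq : ∀ q, 0 < q → q < p → q ∣ p → q ∣ d) (hn : a + b + p + p ≤ n) :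
    ((Finset.univ.filter fun v : Fin n → Fin σ => EE (extF v) n p a b).card : ℤ)
      = ((σ : ℤ) ^ p - (σ : ℤ) ^ d) * cc σ a * cc σ b := by
  have sub : (Finset.univ.filter fun v : Fin n → Fin σ => XX (extF v) n d a b) ⊆
      (Finset.univ.filter fun v : Fin n → Fin σ => XX (extF v) n p a b) := by
    intro v
    simp only [Finset.mem_filter, Finset.mem_univ, true_and]
    rintro ⟨h1, h2, h3⟩
    refine ⟨h1.dvd hd, fun ha h => h2 ha ?_, fun hb h => h3 hb ?_⟩
    · exact h.extend (by omega) h1 hd (by omega) le_rfl (by omega)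
    · exact h.extend (by omega) h1 hd le_rfl (by omega) (by omega)
  have e : (Finset.univ.filter fun v : Fin n → Fin σ => EE (extF v) n p a b) =
      (Finset.univ.filter fun v : Fin n → Fin σ => XX (extF v) n p a b) \
      (Finset.univ.filter fun v : Fin n → Fin σ => XX (extF v) n d a b) := by
    ext v
    simp only [Finset.mem_filter, Finset.mem_univ, true_and, Finset.mem_sdiff]
    unfold EE
    constructor
    · rintro ⟨h1, h2⟩
      exact ⟨h1, fun h => h2 d hd0 hdp hd h.1⟩
    · rintro ⟨h1, h2⟩
      refine ⟨h1, fun q hq0 hqp hqd h => h2 ?_⟩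
      refine ⟨h.dvd (hq q hq0 hqp hqd), fun ha h => h1.2.1 ha (h.dvd hd),
        fun hb h => h1.2.2 hb (h.dvd hd)⟩
  rw [e, Finset.card_sdiff_of_subset sub, Nat.cast_sub (Finset.card_le_card sub),
    card_XX _ _ _ _ _ (by omega) (by omega), card_XX _ _ _ _ _ (by omega) (by omega)]
  ring

open Classical in
theorem card_EE (σ n p a b : ℕ) (hp : 0 < p) (hp5 : p ≤ 5) (hn : a + b + p + p ≤ n) :
    ((Finset.univ.filter fun v : Fin n → Fin σ => EE (extF v) n p a b).card : ℤ)
      = pr σ p * cc σ a * cc σ b := by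
  interval_cases p
  · have : ∀ v : Fin n → Fin σ, EE (extF v) n 1 a b ↔ XX (extF v) n 1 a b := by
      intro v
      refine ⟨fun h => h.1, fun h => ⟨h, fun q h1 h2 => by omega⟩⟩
    simp only [this]
    rw [card_XX _ _ _ _ _ (by omega) (by omega)]
    simp [pr]
  · rw [card_EE_step σ n 2 a b 1 (by omega) (by omega) (by omega) _ hn]
    · simp [pr]
    · intro q h1 h2 h3; interval_cases q <;> omega
  · rw [card_EE_step σ n 3 a b 1 (by omega) (by omega) (by omega) _ hn]
    · simp [pr]
    · intro q h1 h2 h3; interval_cases q <;> omega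
  · rw [card_EE_step σ n 4 a b 2 (by omega) (by omega) (by omega) _ hn]
    · simp [pr]
    · intro q h1 h2 h3; interval_cases q <;> omega
  · rw [card_EE_step σ n 5 a b 1 (by omega) (by omega) (by omega) _ hn]
    · simp [pr]
    · intro q h1 h2 h3; interval_cases q <;> omega

def Idx (w : ℕ) : Finset (ℕ × ℕ × ℕ) :=
  (Finset.range (w + 1) ×ˢ Finset.range (w + 1) ×ˢ Finset.range (w + 1)).filter
    fun t => 0 < t.1 ∧ t.2.1 + t.2.2 + t.1 ≤ w

theorem mem_Idx (w : ℕ) (t : ℕ × ℕ × ℕ) : t ∈ Idx w ↔ 0 < t.1 ∧ t.2.1 + t.2.2 + t.1 ≤ w := by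
  simp only [Idx, Finset.mem_filter, Finset.mem_product, Finset.mem_range]
  constructor
  · exact fun h => h.2
  · exact fun h => ⟨by omega, h⟩

theorem Dev_formula (σ k w : ℕ) (hw : w ≤ 5) (hk : 5 ≤ k) :
    Dev σ k w = ∑ t ∈ Idx w, ((pr σ t.1 * cc σ t.2.1 * cc σ t.2.2 : ℤ) : ℝ) *
      ((1 + if 0 < t.2.2 then (1:ℝ) else 0) / ((t.2.1 + t.2.2 + t.1 : ℕ) : ℝ)
        - 2 / ((w : ℝ) + 1)) := by
  classical
  have hD : Dev σ k w = ∑ v ∈ RepSet σ k w, (Pgc σ k w v - 2 / ((w : ℝ) + 1)) := by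
    unfold Dev
    rw [Finset.sum_sub_distrib, Finset.sum_const, nsmul_eq_mul, mul_comm (2 / ((w : ℝ) + 1))]
  have hR : RepSet σ k w = (Idx w).biUnion fun t =>
      Finset.univ.filter fun v => EE (extF v) (w + k) t.1 t.2.1 t.2.2 := by
    ext v
    simp only [RepSet, Finset.mem_filter, Finset.mem_univ, true_and, Finset.mem_biUnion]
    constructor
    · rintro ⟨i, j, hne, h⟩
      have : ∃ i j : Fin (w + 1), i < j ∧ kmerAt σ k w v i = kmerAt σ k w v j := by
        rcases lt_or_gt_of_ne hne with h' | h'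
        · exact ⟨i, j, h', h⟩
        · exact ⟨j, i, h', h.symm⟩
      obtain ⟨i, j, hij, h⟩ := this
      rw [kmer_eq_iff v i j hij] at h
      have hj := j.2
      obtain ⟨p, a, b, h1, h2, h3⟩ := EE_exists (w := w) (Fin.lt_def.1 hij) (by omega) h
      exact ⟨(p, a, b), (mem_Idx _ _).2 ⟨h1, h2⟩, h3⟩
    · rintro ⟨⟨p, a, b⟩, ht, hE⟩
      rw [mem_Idx] at ht
      obtain ⟨h1, h2⟩ := ht
      simp only at h1 h2 hE
      have hlt : (⟨a, by omega⟩ : Fin (w + 1)) < ⟨a + p, by omega⟩ := by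
        rw [Fin.lt_def]; simp only; omega
      exact ⟨⟨a, by omega⟩, ⟨a + p, by omega⟩, hlt.ne,
        (kmer_EE (by omega) h1 h2 v hE _ _ hlt).2 ⟨le_rfl, by simp only; omega, by simp⟩⟩
  rw [hD, hR, Finset.sum_biUnion]
  · apply Finset.sum_congr rfl
    rintro ⟨p, a, b⟩ ht
    rw [mem_Idx] at ht
    obtain ⟨h1, h2⟩ := ht
    simp only at h1 h2 ⊢
    rw [← card_EE σ (w + k) p a b h1 (by omega) (by omega), Int.cast_natCast, ← nsmul_eq_mul]
    apply Finset.sum_eq_card_nsmul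
    intro v hv
    simp only [Finset.mem_filter, Finset.mem_univ, true_and] at hv
    rw [Pgc_EE (by omega) h1 h2 v hv]
  · rintro ⟨p, a, b⟩ ht ⟨p', a', b'⟩ ht' hne
    rw [Finset.mem_coe, mem_Idx] at ht ht'
    rw [Function.onFun, Finset.disjoint_left]
    intro v hv hv'
    simp only [Finset.mem_filter, Finset.mem_univ, true_and] at hv hv'
    obtain ⟨rfl, rfl, rfl⟩ := EE_unique (by omega) ht.1 ht.2 hv ht'.1 ht'.2 hv'
    exact hne rfl

theorem Dev_formula' (σ k w : ℕ) (hw : w ≤ 5) (hk : 5 ≤ k) :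
    Dev σ k w = ∑ p ∈ Finset.range (w + 1), ∑ a ∈ Finset.range (w + 1),
      ∑ b ∈ Finset.range (w + 1), if 0 < p ∧ a + b + p ≤ w then
      ((pr σ p * cc σ a * cc σ b : ℤ) : ℝ) *
      ((1 + if 0 < b then (1:ℝ) else 0) / ((a + b + p : ℕ) : ℝ) - 2 / ((w : ℝ) + 1)) else 0 := by
  rw [Dev_formula σ k w hw hk, Idx, Finset.sum_filter, Finset.sum_product]
  simp only [Finset.sum_product]

theorem stmt14 (σ k : ℕ) (hσ : 2 ≤ σ) (hk : 5 ≤ k) :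
    Dev σ k 2 - Dev σ k 1 = (σ : ℝ) / 3 ∧
    Dev σ k 3 - Dev σ k 2 = (σ : ℝ) ^ 2 / 6 ∧
    Dev σ k 4 - Dev σ k 3 = (2 * (σ : ℝ) ^ 3 + 3 * (σ : ℝ) ^ 2 - 3 * σ) / 20 ∧
    Dev σ k 5 - Dev σ k 4 =
      (2 * (σ : ℝ) ^ 4 + 2 * (σ : ℝ) ^ 3 - 6 * (σ : ℝ) ^ 2 + 4 * σ) / 30 := by
  rw [Dev_formula' σ k 1 (by omega) hk, Dev_formula' σ k 2 (by omega) hk,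
    Dev_formula' σ k 3 (by omega) hk, Dev_formula' σ k 4 (by omega) hk,
    Dev_formula' σ k 5 (by omega) hk]
  refine ⟨?_, ?_, ?_, ?_⟩ <;>
  · simp [Finset.sum_range_succ, pr, cc]
    ring
end

section
/- For all σ ≥ 2, k ≥ 2, and w ≥ 1, one has DR_σ(k,w+1) ≤ DR_σ(k,w). -/
open Finset

def preW (σ k w : ℕ) (v : Fin (w + 1 + k) → Fin σ) : Fin (w + k) → Fin σ :=
  fun j => v ⟨j.1, by have := j.2; omega⟩

def sufW (σ k w : ℕ) (v : Fin (w + 1 + k) → Fin σ) : Fin (w + k) → Fin σ :=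
  fun j => v ⟨j.1 + 1, by have := j.2; omega⟩

lemma kmer_preW (σ k w : ℕ) (v : Fin (w + 1 + k) → Fin σ) (i : Fin (w + 1)) :
    kmerAt σ k w (preW σ k w v) i = kmerAt σ k (w + 1) v i.castSucc := rfl

lemma kmer_sufW (σ k w : ℕ) (v : Fin (w + 1 + k) → Fin σ) (i : Fin (w + 1)) :
    kmerAt σ k w (sufW σ k w v) i = kmerAt σ k (w + 1) v i.succ := by
  funext j
  simp only [kmerAt, sufW, Fin.val_succ]
  congr 2
  omega

def PA (σ k w : ℕ) (ρ : (Fin k → Fin σ) ≃ Fin (σ ^ k)) (v : Fin (w + k) → Fin σ) : Prop :=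
  ∀ i : Fin (w + 1), ρ (kmerAt σ k w v 0) ≤ ρ (kmerAt σ k w v i)

def PB (σ k w : ℕ) (ρ : (Fin k → Fin σ) ≃ Fin (σ ^ k)) (v : Fin (w + k) → Fin σ) : Prop :=
  (∀ i : Fin (w + 1), ρ (kmerAt σ k w v (Fin.last w)) ≤ ρ (kmerAt σ k w v i)) ∧
    (∀ i : Fin (w + 1), kmerAt σ k w v i = kmerAt σ k w v (Fin.last w) → i = Fin.last w)

lemma PA_pre (σ k w : ℕ) (ρ : (Fin k → Fin σ) ≃ Fin (σ ^ k)) (v : Fin (w + 1 + k) → Fin σ)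
    (h : PA σ k (w + 1) ρ v) : PA σ k w ρ (preW σ k w v) := by
  intro i
  rw [kmer_preW, kmer_preW]
  exact h _

lemma PB_suf (σ k w : ℕ) (ρ : (Fin k → Fin σ) ≃ Fin (σ ^ k)) (v : Fin (w + 1 + k) → Fin σ)
    (h : PB σ k (w + 1) ρ v) : PB σ k w ρ (sufW σ k w v) := by
  refine ⟨fun i => ?_, fun i hi => ?_⟩
  · rw [kmer_sufW, kmer_sufW, Fin.succ_last]
    exact h.1 _
  · rw [kmer_sufW, kmer_sufW, Fin.succ_last] at hi
    have := h.2 _ hi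
    rw [← Fin.succ_last] at this
    exact Fin.succ_injective _ this

lemma PA_PB (σ k w : ℕ) (hw : 1 ≤ w) (ρ : (Fin k → Fin σ) ≃ Fin (σ ^ k))
    (v : Fin (w + k) → Fin σ) (ha : PA σ k w ρ v) (hb : PB σ k w ρ v) : False := by
  have h := ρ.injective (le_antisymm (ha (Fin.last w)) (hb.1 0))
  have := congrArg Fin.val (hb.2 0 h)
  simp at this
  omega

open Classical in
lemma card_GC (σ k w : ℕ) (hk : 1 ≤ k) (hw : 1 ≤ w) (ρ : (Fin k → Fin σ) ≃ Fin (σ ^ k)) :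
    Nat.card {v : Fin (w + 1 + k) → Fin σ // IsGC σ k (w + 1) ρ v} ≤
      σ * Nat.card {v : Fin (w + k) → Fin σ // IsGC σ k w ρ v} := by
  have hs : σ * Nat.card {v : Fin (w + k) → Fin σ // IsGC σ k w ρ v} =
      Nat.card (Fin σ × {v : Fin (w + k) → Fin σ // IsGC σ k w ρ v}) := by
    rw [Nat.card_prod]; simp
  rw [hs]
  have hB : ∀ v : {v : Fin (w + 1 + k) → Fin σ // IsGC σ k (w + 1) ρ v},
      ¬ PA σ k (w + 1) ρ v.1 → PB σ k (w + 1) ρ v.1 := fun v h => v.2.resolve_left h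
  refine Nat.card_le_card_of_injective (fun v =>
    if h : PA σ k (w + 1) ρ v.1 then
      (v.1 ⟨w + k, by omega⟩, ⟨preW σ k w v.1, Or.inl (PA_pre σ k w ρ v.1 h)⟩)
    else (v.1 ⟨0, by omega⟩, ⟨sufW σ k w v.1, Or.inr (PB_suf σ k w ρ v.1 (hB v h))⟩)) ?_
  intro v u huv
  by_cases hv : PA σ k (w + 1) ρ v.1 <;> by_cases hu : PA σ k (w + 1) ρ u.1 <;>
    simp only [hv, hu, dite_true, dite_false, Prod.mk.injEq] at huv <;>
    obtain ⟨huv1, huv2⟩ := huv <;> replace huv2 := congrArg Subtype.val huv2 <;>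
    dsimp only at huv2
  · apply Subtype.ext
    funext j
    by_cases hj : j.1 < w + k
    · exact congrFun huv2 ⟨j.1, hj⟩
    · have : j = ⟨w + k, by omega⟩ := Fin.ext (by have := j.2; simp only; omega)
      rw [this]; exact huv1
  · exact (PA_PB σ k w hw ρ _ (PA_pre σ k w ρ _ hv)
      (huv2 ▸ PB_suf σ k w ρ _ (hB u hu))).elim
  · exact (PA_PB σ k w hw ρ _ (PA_pre σ k w ρ _ hu)
      (huv2 ▸ PB_suf σ k w ρ _ (hB v hv))).elim
  · apply Subtype.ext
    funext j
    obtain ⟨j, hj⟩ := j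
    cases j with
    | zero => exact huv1
    | succ j => exact congrFun huv2 ⟨j, by omega⟩

theorem stmt18 (σ k w : ℕ) (hσ : 2 ≤ σ) (hk : 2 ≤ k) (hw : 1 ≤ w) :
    DR σ k (w + 1) ≤ DR σ k w := by
  unfold DR
  refine div_le_div_of_nonneg_right (Finset.sum_le_sum fun ρ _ => ?_) (Nat.cast_nonneg _)
  unfold Dens
  have h : (Nat.card {v : Fin (w + 1 + k) → Fin σ // IsGC σ k (w + 1) ρ v} : ℝ) ≤
      σ * Nat.card {v : Fin (w + k) → Fin σ // IsGC σ k w ρ v} := by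
    exact_mod_cast card_GC σ k w (by omega) hw ρ
  have hpos : (0 : ℝ) < σ := by exact_mod_cast (by omega : 0 < σ)
  rw [div_le_div_iff₀ (by positivity) (by positivity)]
  have hp : (σ : ℝ) ^ (w + 1 + k) = σ * σ ^ (w + k) := by ring
  rw [hp]
  have := mul_le_mul_of_nonneg_right h (pow_pos hpos (w + k)).le
  linarith
end
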